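/- Let ν = 2 (so n = 4·m_2 with m_2 odd and m_1 = 2·m_2), let a ∈ F_{2^{m_1}}^*, b ∈ F_4^*, and let ω ∈ F_{2^{m_1}}^* have polar decomposition ω = w_2·y in F_{2^{m_1}}^* with w_2 ∈ U_2 and y ∈ F_{2^{m_2}}^*; set γ = b·χ_{m_1}(w_2) and α = χ_{m_1}(a). Then 3·S_2(a,b,ω) = 2^{m_2+1} − 2·C_{m_1}(a,a) − K_{m_1}(a) if γ = α and γ = α^{−1}; 3·S_2(a,b,ω) = −2^{m_2} − 2·C_{m_1}(a,a) − K_{m_1}(a) if γ = α and γ ≠ α^{−1}; 3·S_2(a,b,ω) = 2^{m_2+1} + C_{m_1}(a,a) − K_{m_1}(a) if γ ≠ α and γ = α^{−1}; and 3·S_2(a,b,ω) = −2^{m_2} + C_{m_1}(a,a) − K_{m_1}(a) if γ ≠ α and γ ≠ α^{−1}. -/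

import Mathlib

open Finset

attribute [local instance] Classical.propDecidable

noncomputable section

/-- The absolute trace `Tr^k` of `GF(2^k)`, as a function on an ambient field of
characteristic two containing `GF(2^k)`. -/
def absTr {F : Type*} [Field F] (k : ℕ) (x : F) : F :=
  ∑ i ∈ Finset.range k, x ^ 2 ^ i

/-- The relative field trace `Tr^k_j` from `GF(2^k)` to `GF(2^j)`. -/
def relTr {F : Type*} [Field F] (k j : ℕ) (x : F) : F :=
  ∑ i ∈ Finset.range (k / j), x ^ 2 ^ (j * i)

/-- `(-1)^b` for `b ∈ F_2`, viewed inside an ambient field of characteristic two. -/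
def sgn {F : Type*} [Field F] (b : F) : ℤ := if b = 0 then 1 else -1

/-- The subfield `GF(2^k)` of the ambient field, as a finset. -/
def gf (F : Type*) [Field F] [Fintype F] (k : ℕ) : Finset F :=
  Finset.univ.filter fun x => x ^ 2 ^ k = x

/-- The trace of `F_4` down to `F_2`, `tr_2(y) = y + y²`. -/
def tr2 {F : Type*} [Field F] (y : F) : F := y + y ^ 2

/-- The cubic multiplicative character `χ_k(x) = x^((2^k-1)/3)` of `GF(2^k)`. -/
def chi {F : Type*} [Field F] (k : ℕ) (x : F) : F := x ^ ((2 ^ k - 1) / 3)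

/-- The Walsh transform at `ω` of a Boolean function on `GF(2^n)`
(with values in `F_2` inside the ambient field). -/
def walsh {F : Type*} [Field F] [Fintype F] (n : ℕ) (f : F → F) (ω : F) : ℤ :=
  ∑ x : F, sgn (f x + absTr n (ω * x))

/-- The binary Kloosterman sum `K_k(a)` (with the convention `0⁻¹ = 0`). -/
def kloo {F : Type*} [Field F] [Fintype F] (k : ℕ) (a : F) : ℤ :=
  ∑ x ∈ gf F k, sgn (absTr k (a * x + x⁻¹))

/-- The binary cubic sum `C_k(a,b)`. -/
def cub {F : Type*} [Field F] [Fintype F] (k : ℕ) (a b : F) : ℤ :=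
  ∑ x ∈ gf F k, sgn (absTr k (a * x ^ 3 + b * x))

/-- `f_a(x) = Tr^n(a · x^(2^{m₁}-1))`. -/
def fA {F : Type*} [Field F] (n m1 : ℕ) (a x : F) : F :=
  absTr n (a * x ^ (2 ^ m1 - 1))

/-- `g_b(x) = tr_2(b · χ_n(x))`. -/
def gB {F : Type*} [Field F] (n : ℕ) (b x : F) : F := tr2 (b * chi n x)

/-- The binomial Boolean function `f_{a,b} = f_a + g_b`. -/
def fAB {F : Type*} [Field F] (n m1 : ℕ) (a b x : F) : F :=
  fA n m1 a x + gB n b x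

/-- `U`, the image of `U_1 × ⋯ × U_ν` in `GF(2^n)^*` under multiplication, where
`U_i` is the subgroup of `(2^{m_i}+1)`-th roots of unity and `m_i = 2^{ν-i}·m`. -/
def bigU (F : Type*) [Field F] [Fintype F] (ν m : ℕ) : Finset F :=
  Finset.univ.filter fun u => ∃ c : Fin ν → F,
    (∀ i : Fin ν, c i ^ (2 ^ (2 ^ (ν - 1 - (i : ℕ)) * m) + 1) = 1) ∧ u = ∏ i, c i

/-- For `ν = 2`, the sum `S_2(a, b, ω) = ∑ (−1)^{f_a(u₁)}`, ranging over pairs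
`(u₁, u₂) ∈ U_1 × U_2` such that, with `u = u₁·u₂`, `Tr^n_{m₁}(u·ω) ≠ 0`,
`Tr^n_{m₂}(u·ω) = 0` and `b·χ_n(u₂) = 1`. -/
def S2 {F : Type*} [Field F] [Fintype F] (n m1 m2 : ℕ) (a b ω : F) : ℤ :=
  ∑ p ∈ Finset.univ.filter (fun p : F × F =>
      p.1 ^ (2 ^ m1 + 1) = 1 ∧ p.2 ^ (2 ^ m2 + 1) = 1 ∧
      relTr n m1 (p.1 * p.2 * ω) ≠ 0 ∧
      relTr n m2 (p.1 * p.2 * ω) = 0 ∧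
      b * chi n p.2 = 1),
    sgn (fA n m1 a p.1)

/-- If all fibres of `f : s → t` have at most `c` elements and `#s` is at least `c * #t`,
then all fibres have exactly `c` elements. -/
theorem card_fiber_eq_of_le {A B : Type*} (s : Finset A) (t : Finset B) (f : A → B) (c : ℕ)
    (hf : ∀ x ∈ s, f x ∈ t) (hc : ∀ y ∈ t, #{x ∈ s | f x = y} ≤ c) (hs : c * #t ≤ #s) :
    ∀ y ∈ t, #{x ∈ s | f x = y} = c := by
  have h1 := Finset.card_eq_sum_card_fiberwise (s := s) (t := t) (f := f) hf
  have h2 : ∑ y ∈ t, #{x ∈ s | f x = y} = ∑ y ∈ t, c := by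
    refine le_antisymm (Finset.sum_le_sum hc) ?_
    rw [← h1, Finset.sum_const, smul_eq_mul, mul_comm]
    exact hs
  exact (Finset.sum_eq_sum_iff_of_le hc).1 h2

/-- A finset of roots of a nonzero polynomial has at most `natDegree` elements. -/
theorem card_le_natDegree_of_roots {F : Type*} [Field F] (s : Finset F) (p : Polynomial F)
    (hp : p ≠ 0) (h : ∀ x ∈ s, p.eval x = 0) : #s ≤ p.natDegree := by
  have : s ⊆ p.roots.toFinset := by
    intro x hx
    rw [Multiset.mem_toFinset, Polynomial.mem_roots hp]
    exact h x hx
  exact (Finset.card_le_card this).trans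
    ((Multiset.toFinset_card_le _).trans (Polynomial.card_roots' p))

theorem card_le_of_pow_eq {F : Type*} [Field F] (s : Finset F) (d : ℕ) (hd : 0 < d) (c : F)
    (h : ∀ x ∈ s, x ^ d = c) : #s ≤ d := by
  have := card_le_natDegree_of_roots s (Polynomial.X ^ d - Polynomial.C c)
    (Polynomial.X_pow_sub_C_ne_zero hd c) (fun x hx => by simp [h x hx])
  rwa [Polynomial.natDegree_X_pow_sub_C] at this

/-- The equation `x ^ d + x = c` has at most `d` solutions. -/
theorem card_le_of_pow_add_self {F : Type*} [Field F] (s : Finset F) (d : ℕ) (hd : 1 < d) (c : F)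
    (h : ∀ x ∈ s, x ^ d + x = c) : #s ≤ d := by
  have hdeg : (Polynomial.X ^ d + (Polynomial.X - Polynomial.C c) : Polynomial F).natDegree = d := by
    rw [Polynomial.natDegree_add_eq_left_of_natDegree_lt] <;>
      simp [hd]
  have := card_le_natDegree_of_roots s (Polynomial.X ^ d + (Polynomial.X - Polynomial.C c))
    (by intro h0; rw [h0] at hdeg; simp at hdeg; omega)
    (fun x hx => by simp [← h x hx])
  rwa [hdeg] at this

section Trace

variable {F : Type*} [Field F]

theorem mem_gf [Fintype F] {k : ℕ} {x : F} : x ∈ gf F k ↔ x ^ 2 ^ k = x := by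
  simp [gf]

theorem add_pow_two_pow [CharP F 2] (k : ℕ) (x y : F) :
    (x + y) ^ 2 ^ k = x ^ 2 ^ k + y ^ 2 ^ k :=
  add_pow_char_pow x y 2 k

theorem add_mem_gf [Fintype F] [CharP F 2] {k : ℕ} {x y : F} (hx : x ∈ gf F k)
    (hy : y ∈ gf F k) : x + y ∈ gf F k := by
  rw [mem_gf] at *
  rw [add_pow_two_pow, hx, hy]

theorem mul_mem_gf [Fintype F] {k : ℕ} {x y : F} (hx : x ∈ gf F k)
    (hy : y ∈ gf F k) : x * y ∈ gf F k := by
  rw [mem_gf] at *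
  rw [mul_pow, hx, hy]

theorem pow_mem_gf [Fintype F] {k : ℕ} {x : F} (hx : x ∈ gf F k) (d : ℕ) : x ^ d ∈ gf F k := by
  rw [mem_gf] at *
  rw [← pow_mul, mul_comm, pow_mul, hx]

theorem inv_mem_gf [Fintype F] {k : ℕ} {x : F} (hx : x ∈ gf F k) : x⁻¹ ∈ gf F k := by
  rw [mem_gf] at *
  rw [inv_pow, hx]

theorem zero_mem_gf [Fintype F] {k : ℕ} : (0 : F) ∈ gf F k := by
  simp [mem_gf]

theorem one_mem_gf [Fintype F] {k : ℕ} : (1 : F) ∈ gf F k := by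
  simp [mem_gf]

theorem absTr_zero {k : ℕ} : absTr k (0 : F) = 0 := by
  simp [absTr]

theorem absTr_add [CharP F 2] (k : ℕ) (x y : F) :
    absTr k (x + y) = absTr k x + absTr k y := by
  simp [absTr, add_pow_two_pow, Finset.sum_add_distrib]

theorem absTr_sq_eq [Fintype F] {k : ℕ} {x : F} (hx : x ∈ gf F k) :
    absTr k (x ^ 2) = absTr k x := by
  have h1 : absTr k (x ^ 2) = ∑ i ∈ Finset.range k, x ^ 2 ^ (i + 1) := by
    refine Finset.sum_congr rfl fun i _ => ?_
    rw [← pow_mul, pow_succ, mul_comm]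
  have h2 := Finset.sum_range_succ' (fun i => x ^ 2 ^ i) k
  rw [Finset.sum_range_succ, mem_gf.1 hx, pow_zero, pow_one] at h2
  rw [h1]
  exact (add_right_cancel h2).symm

theorem absTr_sq [CharP F 2] (k : ℕ) (x : F) : absTr k (x ^ 2) = absTr k x ^ 2 := by
  rw [absTr, absTr, sum_pow_char]
  refine Finset.sum_congr rfl fun i _ => ?_
  rw [← pow_mul, ← pow_mul, mul_comm]

theorem absTr_eq_zero_or_one [Fintype F] [CharP F 2] {k : ℕ} {x : F} (hx : x ∈ gf F k) :
    absTr k x = 0 ∨ absTr k x = 1 := by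
  have h := absTr_sq k x
  rw [absTr_sq_eq hx] at h
  have : absTr k x * (absTr k x - 1) = 0 := by linear_combination -h
  rcases mul_eq_zero.1 this with h | h
  · exact Or.inl h
  · exact Or.inr (sub_eq_zero.1 h)

/-- Additivity of the absolute trace turns into multiplicativity of the sign. -/
theorem sgn_absTr_add [Fintype F] [CharP F 2] {k : ℕ} {x y : F} (hx : x ∈ gf F k)
    (hy : y ∈ gf F k) :
    sgn (absTr k (x + y)) = sgn (absTr k x) * sgn (absTr k y) := by
  rw [absTr_add]
  rcases absTr_eq_zero_or_one hx with h | h <;> rcases absTr_eq_zero_or_one hy with h' | h' <;>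
    simp [h, h', sgn, CharTwo.add_self_eq_zero]

theorem absTr_two_mul [CharP F 2] (k : ℕ) (x : F) :
    absTr (2 * k) x = absTr k (x + x ^ 2 ^ k) := by
  rw [absTr_add, two_mul, absTr, Finset.sum_range_add]
  refine congrArg₂ _ rfl (Finset.sum_congr rfl fun i _ => ?_)
  rw [← pow_mul, ← pow_add]

theorem card_absTr_eq_zero_le [Fintype F] {k : ℕ} (hk : 0 < k) :
    #{x ∈ gf F k | absTr k x = 0} ≤ 2 ^ (k - 1) := by
  obtain ⟨k, rfl⟩ : ∃ l, k = l + 1 := ⟨k - 1, by omega⟩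
  set p : Polynomial F := ∑ i ∈ Finset.range k, Polynomial.X ^ 2 ^ i with hp
  have hlt : p.degree < ((2 ^ k : ℕ) : WithBot ℕ) := by
    refine (Polynomial.degree_sum_le _ _).trans_lt ?_
    rw [Finset.sup_lt_iff (WithBot.bot_lt_coe _)]
    intro i hi
    rw [Polynomial.degree_X_pow]
    exact_mod_cast Nat.pow_lt_pow_right (by norm_num) (Finset.mem_range.1 hi)
  have hm : (Polynomial.X ^ 2 ^ k + p).Monic := Polynomial.monic_X_pow_add hlt
  have hdeg : (Polynomial.X ^ 2 ^ k + p).natDegree = 2 ^ k :=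
    Polynomial.natDegree_eq_of_degree_eq_some (by
      rw [Polynomial.degree_add_eq_left_of_degree_lt] <;> simp_all)
  rw [Nat.add_sub_cancel, ← hdeg]
  refine card_le_natDegree_of_roots _ _ hm.ne_zero fun x hx => ?_
  have := (Finset.mem_filter.1 hx).2
  rw [absTr, Finset.sum_range_succ] at this
  rw [← this, hp]
  simp [Polynomial.eval_finsetSum, add_comm]

theorem absTr_sq_add_self [Fintype F] [CharP F 2] {k : ℕ} {x : F} (hx : x ∈ gf F k) :
    absTr k (x ^ 2 + x) = 0 := by
  rw [absTr_add, absTr_sq_eq hx, CharTwo.add_self_eq_zero]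

/-- Additive Hilbert 90 for the Artin–Schreier map. -/
theorem exists_sq_add_self [Fintype F] [CharP F 2] {k : ℕ} (hk : 0 < k)
    (hc : #(gf F k) = 2 ^ k) {c : F} (hcm : c ∈ gf F k) (h0 : absTr k c = 0) :
    ∃ y ∈ gf F k, y ^ 2 + y = c := by
  have hk2 : 2 ^ k = 2 * 2 ^ (k - 1) := by rw [← pow_succ', Nat.sub_add_cancel hk]
  have := card_fiber_eq_of_le (gf F k) {x ∈ gf F k | absTr k x = 0} (fun y => y ^ 2 + y) 2
    (fun x hx => Finset.mem_filter.2
      ⟨add_mem_gf (pow_mem_gf hx 2) hx, absTr_sq_add_self hx⟩)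
    (fun y _ => card_le_of_pow_add_self _ 2 (by norm_num) y
      fun x hx => (Finset.mem_filter.1 hx).2)
    (by rw [hc, hk2]; exact Nat.mul_le_mul_left 2 (card_absTr_eq_zero_le hk))
    c (Finset.mem_filter.2 ⟨hcm, h0⟩)
  have hne : ({x ∈ gf F k | x ^ 2 + x = c} : Finset F).Nonempty := by
    rw [← Finset.card_pos, this]; norm_num
  obtain ⟨y, hy⟩ := hne
  exact ⟨y, (Finset.mem_filter.1 hy).1, (Finset.mem_filter.1 hy).2⟩

theorem exists_absTr_eq_one [Fintype F] [CharP F 2] {k : ℕ} (hk : 0 < k)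
    (hc : #(gf F k) = 2 ^ k) : ∃ x ∈ gf F k, absTr k x = 1 := by
  by_contra! h
  have h1 : ({x ∈ gf F k | absTr k x = 0} : Finset F) = gf F k :=
    Finset.filter_true_of_mem fun x hx => (absTr_eq_zero_or_one hx).resolve_right (h x hx)
  have h2 := card_absTr_eq_zero_le (F := F) hk
  rw [h1, hc] at h2
  exact absurd h2 (not_le.2 (Nat.pow_lt_pow_right (by norm_num) (by omega)))

/-- Orthogonality: a nontrivial additive character sums to zero. -/
theorem sum_sgn_absTr_mul [Fintype F] [CharP F 2] {k : ℕ} (hk : 0 < k)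
    (hc : #(gf F k) = 2 ^ k) {c : F} (hcm : c ∈ gf F k) (h0 : c ≠ 0) :
    ∑ x ∈ gf F k, sgn (absTr k (c * x)) = 0 := by
  obtain ⟨z, hz, hz1⟩ := exists_absTr_eq_one (F := F) hk hc
  have hw : c⁻¹ * z ∈ gf F k := mul_mem_gf (inv_mem_gf hcm) hz
  have h : ∑ x ∈ gf F k, sgn (absTr k (c * x)) = ∑ x ∈ gf F k, -sgn (absTr k (c * x)) := by
    refine Finset.sum_nbij' (fun x => x + c⁻¹ * z) (fun x => x + c⁻¹ * z)
      (fun x hx => add_mem_gf hx hw) (fun x hx => add_mem_gf hx hw)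
      (fun x _ => by simp [add_assoc, CharTwo.add_self_eq_zero])
      (fun x _ => by simp [add_assoc, CharTwo.add_self_eq_zero]) (fun x hx => ?_)
    rw [mul_add, mul_inv_cancel_left₀ h0, sgn_absTr_add (mul_mem_gf hcm hx) hz, hz1]
    simp [sgn]
  rw [Finset.sum_neg_distrib] at h
  omega

/-- The subfield of index two has the expected size. -/
theorem card_gf_of_two_mul [Fintype F] [CharP F 2] {k : ℕ} (hk : 0 < k)
    (hc : #(gf F (2 * k)) = 2 ^ (2 * k)) : #(gf F k) = 2 ^ k := by
  have h1 : 1 < 2 ^ k := Nat.one_lt_two_pow hk.ne'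
  have hle : #(gf F k) ≤ 2 ^ k := card_le_of_pow_add_self _ _ h1 0 fun x hx => by
    rw [mem_gf.1 hx, CharTwo.add_self_eq_zero]
  have hxx : ∀ x ∈ gf F (2 * k), (x ^ 2 ^ k) ^ 2 ^ k = x := fun x hx => by
    rw [← pow_mul, ← pow_add, ← two_mul]; exact mem_gf.1 hx
  have := card_fiber_eq_of_le (gf F (2 * k)) (gf F k) (fun x => x ^ 2 ^ k + x) (2 ^ k)
    (fun x hx => by
      simp only [mem_gf]; rw [add_pow_two_pow, hxx x hx, add_comm])
    (fun y _ => card_le_of_pow_add_self _ _ h1 y fun x hx => (Finset.mem_filter.1 hx).2)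
    (by rw [hc, two_mul, pow_add]; exact Nat.mul_le_mul_left _ hle) 0 zero_mem_gf
  rw [← this]
  congr 1
  ext x
  simp only [Finset.mem_filter, CharTwo.add_eq_zero]
  refine ⟨fun hx => ⟨?_, mem_gf.1 hx⟩, fun hx => mem_gf.2 hx.2⟩
  rw [mem_gf, two_mul, pow_add, pow_mul, mem_gf.1 hx, mem_gf.1 hx]

end Trace

section AddInv

variable {F : Type*} [Field F]

theorem eq_or_eq_inv_of_add_inv_eq {v w : F} (hv : v ≠ 0) (hw : w ≠ 0)
    (h : w + w⁻¹ = v + v⁻¹) : w = v ∨ w = v⁻¹ := by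
  have : (w - v) * (w * v - 1) = 0 := by
    field_simp at h
    linear_combination h
  rcases mul_eq_zero.1 this with h | h
  · exact Or.inl (sub_eq_zero.1 h)
  · exact Or.inr (eq_inv_of_mul_eq_one_left (sub_eq_zero.1 h))

theorem eq_one_of_sq_eq_one [CharP F 2] {v : F} (h : v ^ 2 = 1) : v = 1 := by
  have : (v + 1) ^ 2 = 0 := by
    rw [CharTwo.add_sq, h, one_pow, CharTwo.add_self_eq_zero]
  exact CharTwo.add_eq_zero.1 (pow_eq_zero_iff two_ne_zero |>.1 this)

theorem eq_one_of_add_inv_eq_zero [CharP F 2] {v : F} (hv : v ≠ 0) (h : v + v⁻¹ = 0) : v = 1 := by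
  refine eq_one_of_sq_eq_one ?_
  rw [CharTwo.add_eq_zero] at h
  rw [sq]
  nth_rw 2 [h]
  exact mul_inv_cancel₀ hv

/-- Summing a function of `v + v⁻¹` over a set `s` closed under inversion, when the nonzero
values taken by `v + v⁻¹` on `s` are singled out by the trace of their inverse. -/
theorem sum_add_inv_of_trace [Fintype F] [CharP F 2] {k : ℕ} (s : Finset F) (τ : F)
    (hτ : τ = 0 ∨ τ = 1) (h0 : 0 ∉ s) (h1 : 1 ∈ s) (hinv : ∀ v ∈ s, v⁻¹ ∈ s)
    (hmaps : ∀ v ∈ s, v + v⁻¹ ∈ gf F k)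
    (htr : ∀ x ∈ gf F k, x ≠ 0 → ((∃ v ∈ s, v + v⁻¹ = x) ↔ absTr k x⁻¹ = τ)) (G : F → ℤ) :
    ∑ v ∈ s, G (v + v⁻¹) =
      G 0 + ∑ x ∈ (gf F k).erase 0, (1 + sgn τ * sgn (absTr k x⁻¹)) * G x := by
  have hne : ∀ v ∈ s, v ≠ 0 := fun v hv h => h0 (h ▸ hv)
  rw [← Finset.sum_fiberwise_of_maps_to hmaps, ← Finset.add_sum_erase _ _ zero_mem_gf]
  congr 1
  · have : ({v ∈ s | v + v⁻¹ = 0} : Finset F) = {1} := by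
      ext v
      simp only [Finset.mem_filter, Finset.mem_singleton]
      refine ⟨fun h => eq_one_of_add_inv_eq_zero (hne v h.1) h.2, ?_⟩
      rintro rfl
      exact ⟨h1, by rw [inv_one, CharTwo.add_self_eq_zero]⟩
    rw [this, Finset.sum_singleton, inv_one, CharTwo.add_self_eq_zero]
  · refine Finset.sum_congr rfl fun x hx => ?_
    obtain ⟨hx0, hx⟩ := Finset.mem_erase.1 hx
    have hconst : ∑ v ∈ s with v + v⁻¹ = x, G (v + v⁻¹) =
        (#{v ∈ s | v + v⁻¹ = x} : ℤ) * G x := by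
      rw [Finset.sum_congr rfl (g := fun _ => G x) fun v hv => by rw [(Finset.mem_filter.1 hv).2],
        Finset.sum_const, nsmul_eq_mul]
    rw [hconst]
    congr 1
    by_cases hex : ∃ v ∈ s, v + v⁻¹ = x
    · rw [(htr x hx hx0).1 hex]
      obtain ⟨v, hv, hvx⟩ := hex
      have hset : ({v ∈ s | v + v⁻¹ = x} : Finset F) = {v, v⁻¹} := by
        ext w
        simp only [Finset.mem_filter, Finset.mem_insert, Finset.mem_singleton]
        refine ⟨fun h => eq_or_eq_inv_of_add_inv_eq (hne v hv) (hne w h.1) (h.2.trans hvx.symm), ?_⟩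
        rintro (rfl | rfl)
        · exact ⟨hv, hvx⟩
        · exact ⟨hinv v hv, by rw [inv_inv, add_comm, hvx]⟩
      have hvv : v ≠ v⁻¹ := fun h => hx0 (by rw [← hvx, ← h, CharTwo.add_self_eq_zero])
      rw [hset, Finset.card_pair hvv]
      rcases hτ with rfl | rfl <;> simp [sgn]
    · have hset : ({v ∈ s | v + v⁻¹ = x} : Finset F) = ∅ :=
        Finset.filter_eq_empty_iff.2 fun v hv h => hex ⟨v, hv, h⟩
      have hntr := mt (htr x hx hx0).2 hex
      rw [hset, Finset.card_empty]
      rcases absTr_eq_zero_or_one (inv_mem_gf hx) with h | h <;> rw [h] at hntr ⊢ <;>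
        rcases hτ with rfl | rfl <;> simp [sgn] at hntr ⊢

theorem exists_add_inv_iff [Fintype F] [CharP F 2] {k : ℕ} (hk : 0 < k)
    (hc : #(gf F k) = 2 ^ k) {x : F} (hx : x ∈ gf F k) (hx0 : x ≠ 0) :
    (∃ v ∈ (gf F k).erase 0, v + v⁻¹ = x) ↔ absTr k x⁻¹ = 0 := by
  constructor
  · rintro ⟨v, hv, rfl⟩
    obtain ⟨hv0, hv⟩ := Finset.mem_erase.1 hv
    have hv1 : v + 1 ≠ 0 := fun h => by
      rw [CharTwo.add_eq_zero] at h
      exact hx0 (by rw [h, inv_one, CharTwo.add_self_eq_zero])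
    have heq : (v + v⁻¹)⁻¹ = ((v + 1)⁻¹) ^ 2 + (v + 1)⁻¹ := by
      have hsq : v ^ 2 + 1 = (v + 1) ^ 2 := by rw [CharTwo.add_sq, one_pow]
      have : v + v⁻¹ = (v + 1) ^ 2 / v := by rw [← hsq]; field_simp
      rw [this]
      field_simp
      linear_combination (-1 : F) * CharTwo.two_eq_zero (R := F)
    rw [heq]
    exact absTr_sq_add_self (inv_mem_gf (add_mem_gf hv one_mem_gf))
  · intro h
    obtain ⟨y, hy, hyx⟩ := exists_sq_add_self hk hc (pow_mem_gf (inv_mem_gf hx) 2)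
      ((absTr_sq_eq (inv_mem_gf hx)).trans h)
    have hxy : (x * y) ^ 2 + x * (x * y) = 1 := by
      have : x ^ 2 * (y ^ 2 + y) = 1 := by rw [hyx]; field_simp
      linear_combination this
    have hv0 : x * y ≠ 0 := fun h => by simp [h] at hxy
    refine ⟨x * y, Finset.mem_erase.2 ⟨hv0, mul_mem_gf hx hy⟩, ?_⟩
    rw [← mul_right_inj' hv0, mul_add, mul_inv_cancel₀ hv0]
    linear_combination hxy + (1 - x * (x * y)) * CharTwo.two_eq_zero (R := F)

/-- The group of `(2 ^ k + 1)`-st roots of unity. -/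
def rootsOne (F : Type*) [Field F] [Fintype F] (k : ℕ) : Finset F :=
  Finset.univ.filter fun u => u ^ (2 ^ k + 1) = 1

theorem mem_rootsOne [Fintype F] {k : ℕ} {u : F} : u ∈ rootsOne F k ↔ u ^ (2 ^ k + 1) = 1 := by
  simp [rootsOne]

theorem ne_zero_of_mem_rootsOne [Fintype F] {k : ℕ} {u : F} (h : u ∈ rootsOne F k) : u ≠ 0 := by
  rintro rfl
  simp [mem_rootsOne] at h

theorem pow_two_pow_of_mem_rootsOne [Fintype F] {k : ℕ} {u : F} (h : u ∈ rootsOne F k) :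
    u ^ 2 ^ k = u⁻¹ :=
  eq_inv_of_mul_eq_one_left (by rw [← pow_succ]; exact mem_rootsOne.1 h)

theorem inv_mem_rootsOne [Fintype F] {k : ℕ} {u : F} (h : u ∈ rootsOne F k) :
    u⁻¹ ∈ rootsOne F k := by
  rw [mem_rootsOne] at *
  rw [inv_pow, h, inv_one]

theorem mul_mem_rootsOne [Fintype F] {k : ℕ} {u v : F} (h : u ∈ rootsOne F k)
    (h' : v ∈ rootsOne F k) : u * v ∈ rootsOne F k := by
  rw [mem_rootsOne] at *
  rw [mul_pow, h, h', one_mul]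

theorem add_inv_mem_gf_of_mem_rootsOne [Fintype F] [CharP F 2] {k : ℕ} {u : F}
    (h : u ∈ rootsOne F k) : u + u⁻¹ ∈ gf F k := by
  rw [mem_gf, add_pow_two_pow, inv_pow, pow_two_pow_of_mem_rootsOne h, inv_inv, add_comm]

theorem eq_one_of_mem_gf_of_mem_rootsOne [Fintype F] [CharP F 2] {k : ℕ} {u : F}
    (h : u ∈ gf F k) (h' : u ∈ rootsOne F k) : u = 1 := by
  refine eq_one_of_sq_eq_one ?_
  have := mem_rootsOne.1 h'
  rw [pow_succ, mem_gf.1 h] at this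
  rw [sq, this]

theorem exists_rootsOne_add_inv_iff [Fintype F] [CharP F 2] {k : ℕ} (hk : 0 < k)
    (hc : #(gf F k) = 2 ^ k) (hc2 : #(gf F (2 * k)) = 2 ^ (2 * k))
    {x : F} (hx : x ∈ gf F k) (hx0 : x ≠ 0) :
    (∃ v ∈ rootsOne F k, v + v⁻¹ = x) ↔ absTr k x⁻¹ = 1 := by
  constructor
  · rintro ⟨u, hu, hux⟩
    refine (absTr_eq_zero_or_one (inv_mem_gf hx)).resolve_left fun h => ?_
    obtain ⟨v, hv, hvx⟩ := (exists_add_inv_iff hk hc hx hx0).2 h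
    obtain ⟨hv0, hv⟩ := Finset.mem_erase.1 hv
    have hu1 : u ∈ gf F k := by
      rcases eq_or_eq_inv_of_add_inv_eq hv0 (ne_zero_of_mem_rootsOne hu) (hux.trans hvx.symm)
        with rfl | rfl
      · exact hv
      · exact inv_mem_gf hv
    apply hx0
    rw [← hux, eq_one_of_mem_gf_of_mem_rootsOne hu1 hu, inv_one, CharTwo.add_self_eq_zero]
  · intro h
    have hz : x⁻¹ ^ 2 ∈ gf F k := pow_mem_gf (inv_mem_gf hx) 2
    have hz2 : x⁻¹ ^ 2 ∈ gf F (2 * k) := by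
      rw [mem_gf, two_mul, pow_add, pow_mul, mem_gf.1 hz, mem_gf.1 hz]
    obtain ⟨y, hy, hyx⟩ := exists_sq_add_self (by omega) hc2 hz2 (by
      rw [absTr_two_mul, mem_gf.1 hz, CharTwo.add_self_eq_zero, absTr_zero])
    have hxy : (x * y) ^ 2 + x * (x * y) = 1 := by
      have : x ^ 2 * (y ^ 2 + y) = 1 := by rw [hyx]; field_simp
      linear_combination this
    have hv0 : x * y ≠ 0 := fun h => by simp [h] at hxy
    have hyk : y ∉ gf F k := fun hyk => by
      have h1 := absTr_sq_add_self hyk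
      rw [hyx, absTr_sq_eq (inv_mem_gf hx), h] at h1
      exact one_ne_zero h1
    have hyq : y ^ 2 ^ k = y + 1 := by
      have h1 : (y ^ 2 ^ k) ^ 2 + y ^ 2 ^ k = y ^ 2 + y := by
        rw [← pow_mul, mul_comm, pow_mul, ← add_pow_two_pow, hyx]
        exact mem_gf.1 hz
      have h2 : (y ^ 2 ^ k - y) * (y ^ 2 ^ k - (y + 1)) = 0 := by
        linear_combination h1 - (y ^ 2 ^ k + y ^ 2 ^ k * y - y ^ 2 - y) * CharTwo.two_eq_zero (R := F)
      rcases mul_eq_zero.1 h2 with h2 | h2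
      · exact absurd (mem_gf.2 (sub_eq_zero.1 h2)) hyk
      · exact sub_eq_zero.1 h2
    refine ⟨x * y, ?_, ?_⟩
    · rw [mem_rootsOne, pow_succ, mul_pow, mem_gf.1 hx, hyq]
      linear_combination hxy
    · rw [← mul_right_inj' hv0, mul_add, mul_inv_cancel₀ hv0]
      linear_combination hxy + (1 - x * (x * y)) * CharTwo.two_eq_zero (R := F)

theorem sum_gf_add_inv [Fintype F] [CharP F 2] {k : ℕ} (hk : 0 < k)
    (hc : #(gf F k) = 2 ^ k) (G : F → ℤ) :
    ∑ v ∈ (gf F k).erase 0, G (v + v⁻¹) =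
      G 0 + ∑ x ∈ (gf F k).erase 0, (1 + sgn (absTr k x⁻¹)) * G x := by
  have := sum_add_inv_of_trace (k := k) ((gf F k).erase 0) 0 (Or.inl rfl) (by simp)
    (Finset.mem_erase.2 ⟨one_ne_zero, one_mem_gf⟩)
    (fun v hv => Finset.mem_erase.2 ⟨inv_ne_zero (Finset.mem_erase.1 hv).1,
      inv_mem_gf (Finset.mem_erase.1 hv).2⟩)
    (fun v hv => add_mem_gf (Finset.mem_erase.1 hv).2 (inv_mem_gf (Finset.mem_erase.1 hv).2))
    (fun x hx hx0 => exists_add_inv_iff hk hc hx hx0) G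
  simpa [sgn] using this

theorem sum_rootsOne_add_inv [Fintype F] [CharP F 2] {k : ℕ} (hk : 0 < k)
    (hc : #(gf F k) = 2 ^ k) (hc2 : #(gf F (2 * k)) = 2 ^ (2 * k)) (G : F → ℤ) :
    ∑ v ∈ rootsOne F k, G (v + v⁻¹) =
      G 0 + ∑ x ∈ (gf F k).erase 0, (1 - sgn (absTr k x⁻¹)) * G x := by
  have := sum_add_inv_of_trace (k := k) (rootsOne F k) 1 (Or.inr rfl) (by simp [mem_rootsOne])
    (by simp [mem_rootsOne]) (fun v hv => inv_mem_rootsOne hv)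
    (fun v hv => add_inv_mem_gf_of_mem_rootsOne hv)
    (fun x hx hx0 => exists_rootsOne_add_inv_iff hk hc hc2 hx hx0) G
  have h1 : sgn (1 : F) = -1 := by simp [sgn]
  simpa only [h1, neg_one_mul, ← sub_eq_add_neg] using this

end AddInv

section Cubes

variable {F : Type*} [Field F]

/-- Kloosterman sums and the character sum of `v + v⁻¹` over `GF(2^k)^*`. -/
theorem sum_sgn_mul_add_inv [Fintype F] [CharP F 2] {k : ℕ} (hk : 0 < k) (hc : #(gf F k) = 2 ^ k) {r : F}
    (hr : r ∈ gf F k) (hr0 : r ≠ 0) :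
    ∑ v ∈ (gf F k).erase 0, sgn (absTr k (r * (v + v⁻¹))) = kloo k r - 1 := by
  rw [sum_gf_add_inv hk hc (fun x => sgn (absTr k (r * x))), kloo]
  have h := sum_sgn_absTr_mul hk hc hr hr0
  rw [← Finset.add_sum_erase _ _ zero_mem_gf] at h ⊢
  have h2 : ∑ x ∈ (gf F k).erase 0, (1 + sgn (absTr k x⁻¹)) * sgn (absTr k (r * x)) =
      ∑ x ∈ (gf F k).erase 0, sgn (absTr k (r * x)) +
        ∑ x ∈ (gf F k).erase 0, sgn (absTr k (r * x + x⁻¹)) := by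
    rw [← Finset.sum_add_distrib]
    refine Finset.sum_congr rfl fun x hx => ?_
    have hx := (Finset.mem_erase.1 hx).2
    rw [sgn_absTr_add (mul_mem_gf hr hx) (inv_mem_gf hx)]
    ring
  rw [h2]
  simp only [mul_zero, inv_zero, add_zero, absTr_zero, sgn, if_true] at h ⊢
  omega

theorem sum_rootsOne_sgn_mul_add_inv [Fintype F] [CharP F 2] {k : ℕ} (hk : 0 < k)
    (hc : #(gf F k) = 2 ^ k) (hc2 : #(gf F (2 * k)) = 2 ^ (2 * k)) {r : F} (hr : r ∈ gf F k) (hr0 : r ≠ 0) :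
    ∑ u ∈ rootsOne F k, sgn (absTr k (r * (u + u⁻¹))) = 1 - kloo k r := by
  have h1 := sum_sgn_mul_add_inv hk hc hr hr0
  have h := sum_sgn_absTr_mul hk hc hr hr0
  rw [sum_gf_add_inv hk hc (fun x => sgn (absTr k (r * x)))] at h1
  rw [sum_rootsOne_add_inv hk hc hc2 (fun x => sgn (absTr k (r * x)))]
  rw [← Finset.add_sum_erase _ _ zero_mem_gf] at h
  simp only [add_mul, sub_mul, one_mul, Finset.sum_add_distrib, Finset.sum_sub_distrib] at h1 ⊢
  simp only [mul_zero, absTr_zero, sgn, if_true] at h h1 ⊢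
  omega

theorem cube_add_inv_cube [CharP F 2] {v : F} (hv : v ≠ 0) :
    v ^ 3 + (v ^ 3)⁻¹ = (v + v⁻¹) ^ 3 + (v + v⁻¹) := by
  have h2 := CharTwo.two_eq_zero (R := F)
  have h : v * v⁻¹ = 1 := mul_inv_cancel₀ hv
  rw [← inv_pow]
  linear_combination (-3 * v - 3 * v⁻¹) * h - (2 * v + 2 * v⁻¹) * h2

/-- Cubing permutes the `(2 ^ k + 1)`-st roots of unity when `3 ∣ 2 ^ k - 1`. -/
theorem sum_rootsOne_cube [Fintype F] {k l : ℕ} (hl : 2 ^ k + 2 = 3 * l) (H : F → ℤ) :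
    ∑ u ∈ rootsOne F k, H (u ^ 3) = ∑ u ∈ rootsOne F k, H u := by
  have hu : ∀ u ∈ rootsOne F k, u ^ (3 * l) = u := fun u hu => by
    rw [← hl, pow_succ, mem_rootsOne.1 hu, one_mul]
  have hp : ∀ d, ∀ u ∈ rootsOne F k, u ^ d ∈ rootsOne F k := fun d u hu => by
    rw [mem_rootsOne, ← pow_mul, mul_comm, pow_mul, mem_rootsOne.1 hu, one_pow]
  refine Finset.sum_nbij' (fun u => u ^ 3) (fun u => u ^ l) (hp 3) (hp l)
    (fun u h => ?_) (fun u h => ?_) (fun _ _ => rfl)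
  · rw [← pow_mul, hu u h]
  · rw [← pow_mul, mul_comm, hu u h]

/-- The character sum of `v ^ 3 + v ^ (-3)` in terms of cubic and Kloosterman sums. -/
theorem sum_sgn_mul_cube_add_inv [Fintype F] [CharP F 2] {k l : ℕ} (hl : 2 ^ k + 2 = 3 * l) (hk : 0 < k)
    (hc : #(gf F k) = 2 ^ k) (hc2 : #(gf F (2 * k)) = 2 ^ (2 * k)) {r : F}
    (hr : r ∈ gf F k) (hr0 : r ≠ 0) :
    ∑ v ∈ (gf F k).erase 0, sgn (absTr k (r * (v ^ 3 + (v ^ 3)⁻¹))) =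
      2 * cub k r r + kloo k r - 1 := by
  have h1 := sum_gf_add_inv hk hc (fun x => sgn (absTr k (r * (x ^ 3 + x))))
  have h2 := sum_rootsOne_add_inv hk hc hc2 (fun x => sgn (absTr k (r * (x ^ 3 + x))))
  have h3 := sum_rootsOne_sgn_mul_add_inv hk hc hc2 hr hr0
  rw [← sum_rootsOne_cube hl (fun u => sgn (absTr k (r * (u + u⁻¹))))] at h3
  have h4 : cub k r r = ∑ x ∈ gf F k, sgn (absTr k (r * (x ^ 3 + x))) :=
    Finset.sum_congr rfl fun x _ => by rw [mul_add]
  rw [← Finset.add_sum_erase _ _ zero_mem_gf] at h4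
  rw [Finset.sum_congr rfl fun v hv =>
    by rw [← cube_add_inv_cube (ne_zero_of_mem_rootsOne hv)]] at h2
  rw [Finset.sum_congr rfl fun v hv =>
    by rw [← cube_add_inv_cube (Finset.mem_erase.1 hv).1]] at h1
  simp only [add_mul, sub_mul, one_mul, Finset.sum_add_distrib, Finset.sum_sub_distrib] at h1 h2
  rw [h3] at h2
  rw [h1]
  have h5 : sgn (absTr k (r * ((0 : F) ^ 3 + 0))) = 1 := by simp [absTr_zero, sgn]
  rw [h5] at h1 h2 h4 ⊢
  omega

theorem exists_sq_eq_of_mem_gf [Fintype F] {k : ℕ} (hk : 0 < k) {x : F} (hx : x ∈ gf F k) :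
    ∃ r ∈ gf F k, r ^ 2 = x := by
  refine ⟨x ^ 2 ^ (k - 1), pow_mem_gf hx _, ?_⟩
  rw [← pow_mul, ← pow_succ, Nat.sub_add_cancel hk, mem_gf.1 hx]

theorem sum_gf_sq [Fintype F] {k : ℕ} (hk : 0 < k) (H : F → ℤ) :
    ∑ x ∈ gf F k, H (x ^ 2) = ∑ x ∈ gf F k, H x := by
  have h : ∀ x ∈ gf F k, x ^ (2 * 2 ^ (k - 1)) = x := fun x hx => by
    rw [← pow_succ', Nat.sub_add_cancel hk, mem_gf.1 hx]
  refine Finset.sum_nbij' (fun x => x ^ 2) (fun x => x ^ 2 ^ (k - 1))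
    (fun x hx => pow_mem_gf hx 2) (fun x hx => pow_mem_gf hx _)
    (fun x hx => ?_) (fun x hx => ?_) (fun _ _ => rfl)
  · rw [← pow_mul, h x hx]
  · rw [← pow_mul, mul_comm, h x hx]

theorem kloo_sq [Fintype F] [CharP F 2] {k : ℕ} (hk : 0 < k) {a : F} (ha : a ∈ gf F k) : kloo k (a ^ 2) = kloo k a := by
  rw [kloo, ← sum_gf_sq hk, kloo]
  refine Finset.sum_congr rfl fun x hx => ?_
  rw [← absTr_sq_eq (add_mem_gf (mul_mem_gf ha hx) (inv_mem_gf hx)), CharTwo.add_sq, mul_pow,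
    inv_pow]

theorem cub_sq [Fintype F] [CharP F 2] {k : ℕ} (hk : 0 < k) {a b : F} (ha : a ∈ gf F k) (hb : b ∈ gf F k) :
    cub k (a ^ 2) (b ^ 2) = cub k a b := by
  rw [cub, ← sum_gf_sq hk, cub]
  refine Finset.sum_congr rfl fun x hx => ?_
  rw [← absTr_sq_eq (add_mem_gf (mul_mem_gf ha (pow_mem_gf hx 3)) (mul_mem_gf hb hx)),
    CharTwo.add_sq, mul_pow, mul_pow, ← pow_mul, ← pow_mul]

theorem chi_mul (k : ℕ) (x y : F) : chi k (x * y) = chi k x * chi k y :=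
  mul_pow _ _ _

theorem chi_inv (k : ℕ) (x : F) : chi k x⁻¹ = (chi k x)⁻¹ :=
  inv_pow _ _

theorem chi_one (k : ℕ) : chi k (1 : F) = 1 :=
  one_pow _

theorem chi_ne_zero {k : ℕ} {x : F} (hx : x ≠ 0) : chi k x ≠ 0 :=
  pow_ne_zero _ hx

end Cubes

section Character

variable {F : Type*} [Field F]

theorem pow_sub_one_of_mem_gf [Fintype F] {k : ℕ} {x : F} (hx : x ∈ gf F k) (hx0 : x ≠ 0) :
    x ^ (2 ^ k - 1) = 1 := by
  rw [← mul_left_inj' hx0, ← pow_succ, Nat.sub_add_cancel Nat.one_le_two_pow, mem_gf.1 hx, one_mul]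

theorem two_pow_two_mul_sub_one (m : ℕ) : 2 ^ (2 * m) - 1 = (2 ^ m - 1) * (2 ^ m + 1) := by
  have h : 1 ≤ 2 ^ m := Nat.one_le_two_pow
  obtain ⟨q, hq⟩ := Nat.exists_eq_add_of_le h
  rw [two_mul, pow_add, hq]
  simp only [Nat.add_sub_cancel_left]
  rw [Nat.sub_eq_iff_eq_add (by nlinarith)]
  ring

theorem chi_two_mul {m j : ℕ} (hj : 2 ^ m + 1 = 3 * j) (x : F) :
    chi (2 * m) x = x ^ ((2 ^ m - 1) * j) := by
  rw [chi, two_pow_two_mul_sub_one, hj, Nat.mul_left_comm,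
    Nat.mul_div_cancel_left _ (by norm_num)]

theorem chi_cube [Fintype F] {m j : ℕ} (hj : 2 ^ m + 1 = 3 * j) {x : F}
    (hx : x ∈ gf F (2 * m)) (hx0 : x ≠ 0) : chi (2 * m) x ^ 3 = 1 := by
  rw [chi_two_mul hj, ← pow_mul, mul_assoc, mul_comm j, ← hj, ← two_pow_two_mul_sub_one,
    pow_sub_one_of_mem_gf hx hx0]

theorem chi_eq_one_of_mem_gf [Fintype F] {m j : ℕ} (hj : 2 ^ m + 1 = 3 * j) {x : F}
    (hx : x ∈ gf F m) (hx0 : x ≠ 0) : chi (2 * m) x = 1 := by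
  rw [chi_two_mul hj, pow_mul, pow_sub_one_of_mem_gf hx hx0, one_pow]

theorem chi_of_mem_rootsOne [Fintype F] {m j : ℕ} (hj : 2 ^ m + 1 = 3 * j) {z : F}
    (hz : z ∈ rootsOne F m) : chi (2 * m) z = z ^ j := by
  have h1 : (z ^ j) ^ 3 = 1 := by
    rw [← pow_mul, mul_comm, ← hj, mem_rootsOne.1 hz]
  have h2 : chi (2 * m) z * (z ^ j) ^ 2 = 1 := by
    rw [chi_two_mul hj, mul_comm, pow_mul' z, ← pow_add, ← pow_mul, mul_comm j, pow_mul]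
    have : 2 + (2 ^ m - 1) = 2 ^ m + 1 := by
      have : 1 ≤ 2 ^ m := Nat.one_le_two_pow
      omega
    rw [this, mem_rootsOne.1 hz, one_pow]
  calc chi (2 * m) z = chi (2 * m) z * (z ^ j) ^ 3 := by rw [h1, mul_one]
    _ = chi (2 * m) z * (z ^ j) ^ 2 * z ^ j := by ring
    _ = z ^ j := by rw [h2, one_mul]

theorem gf_subset_gf_two_mul [Fintype F] {m : ℕ} {x : F} (hx : x ∈ gf F m) :
    x ∈ gf F (2 * m) := by
  rw [mem_gf, two_mul, pow_add, pow_mul, mem_gf.1 hx, mem_gf.1 hx]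

theorem rootsOne_subset_gf_two_mul [Fintype F] {m : ℕ} {x : F} (hx : x ∈ rootsOne F m) :
    x ∈ gf F (2 * m) := by
  rw [mem_gf, two_mul, pow_add, pow_mul, pow_two_pow_of_mem_rootsOne hx, inv_pow,
    pow_two_pow_of_mem_rootsOne hx, inv_inv]

/-- Existence of the polar decomposition. -/
theorem exists_polar [Fintype F] {m : ℕ} (hm : 0 < m) {t : F}
    (ht : t ∈ gf F (2 * m)) (ht0 : t ≠ 0) :
    ∃ z ∈ rootsOne F m, ∃ s ∈ gf F m, s ≠ 0 ∧ z * s = t := by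
  have hN : t ^ (2 ^ m + 1) ∈ gf F m := by
    rw [mem_gf, ← pow_mul, add_mul, one_mul, ← pow_add, ← two_mul, pow_add, mem_gf.1 ht, pow_succ,
      mul_comm]
  obtain ⟨s, hs, hst⟩ := exists_sq_eq_of_mem_gf hm hN
  have hs0 : s ≠ 0 := by
    rintro rfl
    exact pow_ne_zero _ ht0 (by rw [← hst]; simp)
  refine ⟨t * s⁻¹, ?_, s, hs, hs0, inv_mul_cancel_right₀ hs0 t⟩
  rw [mem_rootsOne, mul_pow, inv_pow, pow_succ s, mem_gf.1 hs, ← sq, hst,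
    mul_inv_cancel₀ (pow_ne_zero _ ht0)]

theorem polar_unique [Fintype F] [CharP F 2] {m : ℕ} {z z' s s' : F} (hz : z ∈ rootsOne F m)
    (hz' : z' ∈ rootsOne F m) (hs : s ∈ gf F m) (hs' : s' ∈ gf F m) (hs0 : s ≠ 0)
    (h : z * s = z' * s') : z = z' ∧ s = s' := by
  have hz0 := ne_zero_of_mem_rootsOne hz
  have hz0' := ne_zero_of_mem_rootsOne hz'
  have h1 : z * z'⁻¹ = s' * s⁻¹ := by
    field_simp
    exact h
  have h2 : z * z'⁻¹ = 1 :=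
    eq_one_of_mem_gf_of_mem_rootsOne (by rw [h1]; exact mul_mem_gf hs' (inv_mem_gf hs))
      (mul_mem_rootsOne hz (inv_mem_rootsOne hz'))
  have h3 : z = z' := (mul_inv_eq_one₀ hz0').1 h2
  exact ⟨h3, mul_left_cancel₀ hz0' (h3 ▸ h)⟩

theorem sum_polar [Fintype F] [CharP F 2] {m : ℕ} (hm : 0 < m) (H : F → ℤ) :
    ∑ t ∈ (gf F (2 * m)).erase 0, H t =
      ∑ z ∈ rootsOne F m, ∑ s ∈ (gf F m).erase 0, H (z * s) := by
  rw [← Finset.sum_product']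
  symm
  refine Finset.sum_nbij (fun p => p.1 * p.2) (fun p hp => ?_) (fun p hp p' hp' h => ?_)
    (fun t ht => ?_) (fun _ _ => rfl)
  · obtain ⟨hz, hs⟩ := Finset.mem_product.1 hp
    obtain ⟨hs0, hs⟩ := Finset.mem_erase.1 hs
    exact Finset.mem_erase.2 ⟨mul_ne_zero (ne_zero_of_mem_rootsOne hz) hs0,
      mul_mem_gf (rootsOne_subset_gf_two_mul hz) (gf_subset_gf_two_mul hs)⟩
  · obtain ⟨hz, hs⟩ := Finset.mem_product.1 hp
    obtain ⟨hz', hs'⟩ := Finset.mem_product.1 hp'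
    have := polar_unique hz hz' (Finset.mem_erase.1 hs).2 (Finset.mem_erase.1 hs').2
      (Finset.mem_erase.1 hs).1 h
    exact Prod.ext this.1 this.2
  · obtain ⟨ht0, ht⟩ := Finset.mem_erase.1 ht
    obtain ⟨z, hz, s, hs, hs0, rfl⟩ := exists_polar hm ht ht0
    exact ⟨(z, s), Finset.mem_coe.2 (Finset.mem_product.2 ⟨hz, Finset.mem_erase.2 ⟨hs0, hs⟩⟩), rfl⟩

theorem card_rootsOne [Fintype F] [CharP F 2] {m : ℕ} (hm : 0 < m)
    (hc : #(gf F m) = 2 ^ m) (hc2 : #(gf F (2 * m)) = 2 ^ (2 * m)) :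
    #(rootsOne F m) = 2 ^ m + 1 := by
  have h := sum_polar (F := F) hm (fun _ => 1)
  simp only [Finset.sum_const, mul_one, nsmul_eq_mul] at h
  rw [Finset.card_erase_of_mem zero_mem_gf, Finset.card_erase_of_mem zero_mem_gf, hc, hc2,
    two_pow_two_mul_sub_one] at h
  have h1 : 1 < 2 ^ m := Nat.one_lt_two_pow hm.ne'
  have h2 : (2 ^ m - 1) * (2 ^ m + 1) = #(rootsOne F m) * (2 ^ m - 1) := by exact_mod_cast h
  rw [mul_comm] at h2
  exact (Nat.eq_of_mul_eq_mul_right (by omega) h2).symm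

/-- The cubic character is equidistributed on the `(2 ^ m + 1)`-st roots of unity. -/
theorem card_rootsOne_chi_eq [Fintype F] [CharP F 2] {m j : ℕ} (hm : 0 < m)
    (hj : 2 ^ m + 1 = 3 * j) (hc : #(gf F m) = 2 ^ m) (hc2 : #(gf F (2 * m)) = 2 ^ (2 * m))
    {δ : F} (hδ : δ ^ 3 = 1) : #{z ∈ rootsOne F m | chi (2 * m) z = δ} = j := by
  refine card_fiber_eq_of_le (rootsOne F m) (Finset.univ.filter fun y : F => y ^ 3 = 1)
    (chi (2 * m)) j (fun z hz => ?_) (fun y _ => ?_) ?_ δ (by simpa using hδ)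
  · simpa using chi_cube hj (rootsOne_subset_gf_two_mul hz) (ne_zero_of_mem_rootsOne hz)
  · refine card_le_of_pow_eq _ j (by have := Nat.one_le_two_pow (n := m); omega) y fun z hz => ?_
    obtain ⟨hz, hzy⟩ := Finset.mem_filter.1 hz
    rw [← chi_of_mem_rootsOne hj hz, hzy]
  · rw [card_rootsOne hm hc hc2, hj, mul_comm]
    refine Nat.mul_le_mul_right _ (card_le_of_pow_eq _ 3 (by norm_num) 1 fun x hx => ?_)
    simpa using hx

/-- Evaluation of the semiprimitive cubic Gauss periods. -/
theorem sum_chi_eq_sgn_absTr [Fintype F] [CharP F 2] {m j : ℕ} (hm : 0 < m)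
    (hj : 2 ^ m + 1 = 3 * j) (hc : #(gf F m) = 2 ^ m) (hc2 : #(gf F (2 * m)) = 2 ^ (2 * m))
    {δ : F} (hδ : δ ^ 3 = 1) :
    ∑ t ∈ (gf F (2 * m)).erase 0 with chi (2 * m) t = δ, sgn (absTr (2 * m) t) =
      (if δ = 1 then 2 ^ m else 0) - (j : ℤ) := by
  rw [Finset.sum_filter, sum_polar hm]
  have hin : ∀ z ∈ rootsOne F m, ∑ s ∈ (gf F m).erase 0,
      (if chi (2 * m) (z * s) = δ then sgn (absTr (2 * m) (z * s)) else 0) =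
      if chi (2 * m) z = δ then (if z = 1 then 2 ^ m else 0) - 1 else 0 := by
    intro z hz
    have h1 : ∀ s ∈ (gf F m).erase 0,
        (if chi (2 * m) (z * s) = δ then sgn (absTr (2 * m) (z * s)) else 0) =
        if chi (2 * m) z = δ then sgn (absTr m ((z + z⁻¹) * s)) else 0 := by
      intro s hs
      obtain ⟨hs0, hs⟩ := Finset.mem_erase.1 hs
      rw [chi_mul, chi_eq_one_of_mem_gf hj hs hs0, mul_one, absTr_two_mul, mul_pow,
        pow_two_pow_of_mem_rootsOne hz, mem_gf.1 hs, ← add_mul]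
    rw [Finset.sum_congr rfl h1]
    split_ifs with h2 h3
    · subst h3
      rw [Finset.sum_congr rfl (g := fun _ => 1) fun s _ => by
        rw [inv_one, CharTwo.add_self_eq_zero, zero_mul, absTr_zero]; simp [sgn]]
      rw [Finset.sum_const, Finset.card_erase_of_mem zero_mem_gf, hc, nsmul_eq_mul, mul_one,
        Nat.cast_sub Nat.one_le_two_pow]
      push_cast
      rfl
    · have hz0 : z + z⁻¹ ≠ 0 := fun h =>
        h3 (eq_one_of_add_inv_eq_zero (ne_zero_of_mem_rootsOne hz) h)
      have h4 := sum_sgn_absTr_mul hm hc (add_inv_mem_gf_of_mem_rootsOne hz) hz0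
      rw [← Finset.add_sum_erase _ _ zero_mem_gf] at h4
      simp only [mul_zero, absTr_zero, sgn, if_true] at h4 ⊢
      omega
    · exact Finset.sum_const_zero
  rw [Finset.sum_congr rfl hin, ← Finset.sum_filter, Finset.sum_sub_distrib, Finset.sum_const,
    card_rootsOne_chi_eq hm hj hc hc2 hδ, nsmul_eq_mul, mul_one]
  congr 1
  rw [Finset.sum_ite_eq' _ (1 : F) (fun _ => (2 : ℤ) ^ m)]
  simp [mem_rootsOne, chi_one, eq_comm]

/-- Cubing is three-to-one from `GF(2^(2m))^*` onto the kernel of the cubic character. -/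
theorem sum_cube [Fintype F] {m j : ℕ} (hm : 0 < m) (hj : 2 ^ m + 1 = 3 * j)
    (hc2 : #(gf F (2 * m)) = 2 ^ (2 * m)) (H : F → ℤ) :
    ∑ v ∈ (gf F (2 * m)).erase 0, H (v ^ 3) =
      3 * ∑ x ∈ (gf F (2 * m)).erase 0 with chi (2 * m) x = 1, H x := by
  have h1 : 1 < 2 ^ m := Nat.one_lt_two_pow hm.ne'
  have hmaps : ∀ v ∈ (gf F (2 * m)).erase 0,
      v ^ 3 ∈ ((gf F (2 * m)).erase 0).filter fun x => chi (2 * m) x = 1 := fun v hv => by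
    obtain ⟨hv0, hv⟩ := Finset.mem_erase.1 hv
    refine Finset.mem_filter.2 ⟨Finset.mem_erase.2 ⟨pow_ne_zero _ hv0, pow_mem_gf hv 3⟩, ?_⟩
    rw [chi, ← pow_mul, mul_comm, pow_mul]
    exact chi_cube hj hv hv0
  have hcard := card_fiber_eq_of_le _ _ (fun v : F => v ^ 3) 3 hmaps
    (fun y _ => card_le_of_pow_eq _ 3 (by norm_num) y fun x hx => (Finset.mem_filter.1 hx).2)
    (by
      rw [Finset.card_erase_of_mem zero_mem_gf, hc2, two_pow_two_mul_sub_one, hj,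
        Nat.mul_left_comm]
      refine Nat.mul_le_mul_left _ (card_le_of_pow_eq _ _
        (Nat.mul_pos (by omega) (by omega)) 1 fun x hx => ?_)
      rw [← chi_two_mul hj]
      exact (Finset.mem_filter.1 hx).2)
  rw [← Finset.sum_fiberwise_of_maps_to hmaps, Finset.mul_sum]
  refine Finset.sum_congr rfl fun x hx => ?_
  rw [Finset.sum_congr rfl (g := fun _ => H x) fun v hv => by rw [(Finset.mem_filter.1 hv).2],
    Finset.sum_const, hcard x hx, nsmul_eq_mul]
  rfl

/-- Inversion swaps the character values `ε` and `ε⁻¹` in the sum of `x + x⁻¹`. -/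
theorem sum_chi_eq_inv [Fintype F] {k : ℕ} (r ε : F) :
    ∑ x ∈ (gf F k).erase 0 with chi k x = ε⁻¹, sgn (absTr k (r * (x + x⁻¹))) =
      ∑ x ∈ (gf F k).erase 0 with chi k x = ε, sgn (absTr k (r * (x + x⁻¹))) := by
  have hmem : ∀ δ x : F, x ∈ ((gf F k).erase 0).filter (fun x => chi k x = δ) →
      x⁻¹ ∈ ((gf F k).erase 0).filter (fun x => chi k x = δ⁻¹) := by
    intro δ x hx
    obtain ⟨hx, hxδ⟩ := Finset.mem_filter.1 hx
    obtain ⟨hx0, hx⟩ := Finset.mem_erase.1 hx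
    exact Finset.mem_filter.2 ⟨Finset.mem_erase.2 ⟨inv_ne_zero hx0, inv_mem_gf hx⟩,
      by rw [chi_inv, hxδ]⟩
  refine Finset.sum_nbij' (fun x => x⁻¹) (fun x => x⁻¹) (fun x hx => ?_) (hmem ε)
    (fun x _ => inv_inv x) (fun x _ => inv_inv x) (fun x _ => by rw [inv_inv, add_comm])
  have := hmem _ x hx
  rwa [inv_inv] at this

/-- The character sum of `x + x⁻¹` over a cubic class. -/
theorem sum_chi_eq_sgn_mul_add_inv [Fintype F] [CharP F 2] {m j : ℕ} (hm : 0 < m)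
    (hj : 2 ^ m + 1 = 3 * j) (hc2 : #(gf F (2 * m)) = 2 ^ (2 * m))
    (hc4 : #(gf F (2 * (2 * m))) = 2 ^ (2 * (2 * m))) {r ε : F} (hr : r ∈ gf F (2 * m))
    (hr0 : r ≠ 0) (hε : ε ^ 3 = 1) :
    3 * ∑ x ∈ (gf F (2 * m)).erase 0 with chi (2 * m) x = ε,
        sgn (absTr (2 * m) (r * (x + x⁻¹))) =
      (if ε = 1 then 2 else -1) * cub (2 * m) r r + kloo (2 * m) r - 1 := by
  have hl : ∃ l, 2 ^ (2 * m) + 2 = 3 * l := by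
    have h := two_pow_two_mul_sub_one m
    have h1 : 1 ≤ 2 ^ (2 * m) := Nat.one_le_two_pow
    rw [hj, Nat.mul_left_comm] at h
    exact ⟨(2 ^ m - 1) * j + 1, by omega⟩
  obtain ⟨l, hl⟩ := hl
  have hone := sum_sgn_mul_cube_add_inv hl (by omega) hc2 hc4 hr hr0
  rw [sum_cube hm hj hc2 (fun x => sgn (absTr (2 * m) (r * (x + x⁻¹))))] at hone
  split_ifs with h
  · rw [h, hone]
  · have hε0 : ε ≠ 0 := by rintro rfl; simp at hε
    have hsq : ε⁻¹ = ε ^ 2 := (eq_inv_of_mul_eq_one_left (by rw [← hε]; ring)).symm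
    have hsum : ε ^ 2 + ε + 1 = 0 := by
      have : (ε - 1) * (ε ^ 2 + ε + 1) = 0 := by linear_combination hε
      exact (mul_eq_zero.1 this).resolve_left (sub_ne_zero.2 h)
    have hne : ε⁻¹ ≠ 1 := fun h' => h (inv_eq_one.1 h')
    have hne' : ε⁻¹ ≠ ε := fun h' => h (mul_left_cancel₀ hε0 (by rw [mul_one, ← sq, ← hsq, h']))
    have htot := sum_sgn_mul_add_inv (by omega) hc2 hr hr0
    have hinv := sum_chi_eq_inv (k := 2 * m) r ε
    have hsplit : ∑ x ∈ (gf F (2 * m)).erase 0, sgn (absTr (2 * m) (r * (x + x⁻¹))) =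
        ∑ x ∈ (gf F (2 * m)).erase 0 with chi (2 * m) x = 1,
          sgn (absTr (2 * m) (r * (x + x⁻¹))) +
        ∑ x ∈ (gf F (2 * m)).erase 0 with chi (2 * m) x = ε,
          sgn (absTr (2 * m) (r * (x + x⁻¹))) +
        ∑ x ∈ (gf F (2 * m)).erase 0 with chi (2 * m) x = ε⁻¹,
          sgn (absTr (2 * m) (r * (x + x⁻¹))) := by
      rw [Finset.sum_filter, Finset.sum_filter, Finset.sum_filter, ← Finset.sum_add_distrib,
        ← Finset.sum_add_distrib]
      refine Finset.sum_congr rfl fun x hx => ?_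
      obtain ⟨hx0, hx⟩ := Finset.mem_erase.1 hx
      have h3 := chi_cube hj hx hx0
      have : (chi (2 * m) x - 1) * ((chi (2 * m) x - ε) * (chi (2 * m) x - ε⁻¹)) = 0 := by
        rw [hsq]
        linear_combination h3 - hε + (chi (2 * m) x * ε - chi (2 * m) x ^ 2) * hsum
      rcases mul_eq_zero.1 this with h4 | h4
      · rw [sub_eq_zero.1 h4]
        simp [Ne.symm h, Ne.symm hne]
      · rcases mul_eq_zero.1 h4 with h4 | h4
        · rw [sub_eq_zero.1 h4]
          simp [h, Ne.symm hne']
        · rw [sub_eq_zero.1 h4]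
          simp only [hne, hne', if_true, if_false]
          ring
    omega

end Character

section Reduction

variable {F : Type*} [Field F]

theorem relTr_four_mul_two_mul [Fintype F] [CharP F 2] {m : ℕ} (hm : 0 < m) {u x : F}
    (hu : u ∈ rootsOne F (2 * m)) (hx : x ∈ gf F (2 * m)) :
    relTr (4 * m) (2 * m) (u * x) = x * (u + u⁻¹) := by
  have h : 4 * m / (2 * m) = 2 := Nat.div_eq_of_eq_mul_left (by omega) (by ring)
  rw [relTr, h, Finset.sum_range_succ, Finset.sum_range_one, mul_zero, mul_one, pow_zero, pow_one,
    mul_pow, pow_two_pow_of_mem_rootsOne hu, mem_gf.1 hx]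
  ring

theorem relTr_four_mul_self [Fintype F] [CharP F 2] {m : ℕ} (hm : 0 < m) {u x : F}
    (hu : u ∈ rootsOne F (2 * m)) (hx : x ∈ gf F (2 * m)) :
    relTr (4 * m) m (u * x) = 0 ↔ x * (u + u⁻¹) ∈ gf F m := by
  have h : 4 * m / m = 4 := Nat.div_eq_of_eq_mul_left hm rfl
  have h2 := relTr_four_mul_two_mul hm hu hx
  have hx2 : (u * x) ^ 2 ^ (2 * m) = x * (u + u⁻¹) - u * x := by
    rw [mul_pow, pow_two_pow_of_mem_rootsOne hu, mem_gf.1 hx]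
    ring
  have h3 : relTr (4 * m) m (u * x) = x * (u + u⁻¹) + (x * (u + u⁻¹)) ^ 2 ^ m := by
    have h4 : x * (u + u⁻¹) = u * x + (u * x) ^ 2 ^ (2 * m) := by rw [hx2]; ring
    rw [h4, add_pow_two_pow, relTr, h]
    simp only [Finset.sum_range_succ, Finset.sum_range_zero, zero_add, mul_zero, pow_zero, pow_one,
      mul_one]
    have e1 : ((u * x) ^ 2 ^ (2 * m)) ^ 2 ^ m = (u * x) ^ 2 ^ (m * 3) := by
      rw [← pow_mul, ← pow_add]
      ring_nf
    rw [e1, mul_comm m 2]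
    ring
  rw [h3, CharTwo.add_eq_zero, mem_gf, eq_comm]

theorem chi_four_mul [Fintype F] {m j : ℕ} (hj : 2 ^ m + 1 = 3 * j) {x : F}
    (hx : x ∈ gf F (2 * m)) (hx0 : x ≠ 0) : chi (4 * m) x = (chi (2 * m) x)⁻¹ := by
  have h := two_pow_two_mul_sub_one m
  have h1 : 1 ≤ 2 ^ (2 * m) := Nat.one_le_two_pow
  have h4 : (2 ^ (4 * m) - 1) / 3 = (2 ^ m - 1) * j * (2 ^ (2 * m) + 1) := by
    rw [show 4 * m = 2 * (2 * m) by ring, two_pow_two_mul_sub_one, h, hj]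
    refine Nat.div_eq_of_eq_mul_left (by norm_num) ?_
    ring
  have h5 : 2 ^ (2 * m) + 1 = 3 * ((2 ^ m - 1) * j) + 2 := by
    rw [hj] at h
    have : (2 ^ m - 1) * (3 * j) = 3 * ((2 ^ m - 1) * j) := by ring
    omega
  have h3 := chi_cube hj hx hx0
  rw [chi, h4, pow_mul, ← chi_two_mul hj, h5, pow_add, pow_mul, h3, one_pow, one_mul]
  exact eq_inv_of_mul_eq_one_left (by rw [← h3]; ring)

theorem fA_of_mem_rootsOne [Fintype F] [CharP F 2] {k : ℕ} {c u : F} (hc : c ∈ gf F k)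
    (hu : u ∈ rootsOne F k) :
    fA (2 * k) k (c ^ 2) u = absTr k (c * (u + u⁻¹)) := by
  have hu0 := ne_zero_of_mem_rootsOne hu
  have h1 : u ^ (2 ^ k - 1) = u⁻¹ ^ 2 := by
    have h2 : u ^ (2 ^ k - 1) * u = u⁻¹ := by
      rw [← pow_succ, Nat.sub_add_cancel Nat.one_le_two_pow, pow_two_pow_of_mem_rootsOne hu]
    rw [← mul_left_inj' hu0, h2]
    field_simp
  have h3 : (u⁻¹) ^ 2 ^ k = u := by rw [inv_pow, pow_two_pow_of_mem_rootsOne hu, inv_inv]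
  have h4 : c ^ 2 * u⁻¹ ^ 2 + (c ^ 2 * u⁻¹ ^ 2) ^ 2 ^ k = (c * (u + u⁻¹)) ^ 2 := by
    rw [mul_pow, ← pow_mul, ← pow_mul, mul_comm 2, pow_mul, pow_mul, mem_gf.1 hc, h3, mul_pow,
      CharTwo.add_sq]
    ring
  rw [fA, h1, absTr_two_mul, h4,
    absTr_sq_eq (mul_mem_gf hc (add_inv_mem_gf_of_mem_rootsOne hu))]

/-- Given `u₁`, the conditions defining `S_2` determine `u₂`, and leave one condition on `u₁`. -/
theorem S2_eq_sum_rootsOne [Fintype F] [CharP F 2] {m j : ℕ} (hm : 0 < m)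
    (hj : 2 ^ m + 1 = 3 * j) {b c ω : F} (hc : c ∈ gf F (2 * m)) (hω : ω ∈ gf F (2 * m))
    (hω0 : ω ≠ 0) :
    S2 (4 * m) (2 * m) m (c ^ 2) b ω = ∑ u ∈ rootsOne F (2 * m),
      if u + u⁻¹ ≠ 0 ∧ b * chi (2 * m) ω * chi (2 * m) (u + u⁻¹) = 1
        then sgn (absTr (2 * m) (c * (u + u⁻¹))) else 0 := by
  rw [S2, Finset.sum_filter, ← Finset.univ_product_univ, Finset.sum_product, rootsOne,
    Finset.sum_filter]
  refine Finset.sum_congr rfl fun u _ => ?_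
  by_cases hu : u ^ (2 ^ (2 * m) + 1) = 1
  swap
  · simp [hu]
  have hu' : u ∈ rootsOne F (2 * m) := mem_rootsOne.2 hu
  have htm := add_inv_mem_gf_of_mem_rootsOne hu'
  have hfA := fA_of_mem_rootsOne hc hu'
  rw [← mul_assoc] at hfA
  rw [if_pos hu]
  by_cases ht : u + u⁻¹ = 0
  · rw [if_neg (fun h => h.1 ht)]
    refine Finset.sum_eq_zero fun v _ => if_neg ?_
    rintro ⟨-, h2, h3, -⟩
    rw [mul_assoc, relTr_four_mul_two_mul hm hu'
      (mul_mem_gf (rootsOne_subset_gf_two_mul (mem_rootsOne.2 h2)) hω), ht, mul_zero] at h3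
    exact h3 rfl
  obtain ⟨z, hz, s, hs, hs0, hzs⟩ := exists_polar hm (mul_mem_gf hω htm) (mul_ne_zero hω0 ht)
  have hz0 := ne_zero_of_mem_rootsOne hz
  have hchi : chi (2 * m) z = chi (2 * m) ω * chi (2 * m) (u + u⁻¹) := by
    rw [← chi_mul, ← hzs, chi_mul, chi_eq_one_of_mem_gf hj hs hs0, mul_one]
  have hiff : ∀ v : F, (u ^ (2 ^ (2 * m) + 1) = 1 ∧ v ^ (2 ^ m + 1) = 1 ∧
      relTr (4 * m) (2 * m) (u * v * ω) ≠ 0 ∧ relTr (4 * m) m (u * v * ω) = 0 ∧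
      b * chi (4 * m) v = 1) ↔ (v = z⁻¹ ∧ (u + u⁻¹ ≠ 0 ∧
        b * chi (2 * m) ω * chi (2 * m) (u + u⁻¹) = 1)) := by
    intro v
    rw [mul_assoc u v ω, mul_assoc b, ← hchi]
    constructor
    · rintro ⟨-, hv, -, h4, h5⟩
      have hv := mem_rootsOne.2 hv
      have hv2 := rootsOne_subset_gf_two_mul hv
      rw [relTr_four_mul_self hm hu' (mul_mem_gf hv2 hω), mul_assoc, ← hzs, ← mul_assoc] at h4
      have h6 := eq_one_of_mem_gf_of_mem_rootsOne
        (u := v * z) (by simpa [mul_assoc, hs0] using mul_mem_gf h4 (inv_mem_gf hs))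
        (mul_mem_rootsOne hv hz)
      have h7 := eq_inv_of_mul_eq_one_left h6
      rw [chi_four_mul hj hv2 (ne_zero_of_mem_rootsOne hv), h7, chi_inv, inv_inv] at h5
      exact ⟨h7, ht, h5⟩
    · rintro ⟨rfl, -, h5⟩
      have hv := inv_mem_rootsOne hz
      have hv2 := rootsOne_subset_gf_two_mul hv
      have h6 : z⁻¹ * ω * (u + u⁻¹) = s := by
        rw [mul_assoc, ← hzs, inv_mul_cancel_left₀ hz0]
      refine ⟨hu, mem_rootsOne.1 hv, ?_, ?_, ?_⟩
      · rw [relTr_four_mul_two_mul hm hu' (mul_mem_gf hv2 hω), h6]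
        exact hs0
      · rw [relTr_four_mul_self hm hu' (mul_mem_gf hv2 hω), h6]
        exact hs
      · rw [chi_four_mul hj hv2 (inv_ne_zero hz0), chi_inv, inv_inv, h5]
  simp only [hiff, ite_and]
  rw [Finset.sum_ite_eq' Finset.univ z⁻¹]
  simp only [Finset.mem_univ, if_true]
  rw [← fA_of_mem_rootsOne hc hu', show 2 * (2 * m) = 4 * m by ring]

/-- Scaling the summation variable by `c` in a sum over a class of the cubic character. -/
theorem sum_chi_mul_eq [Fintype F] {k : ℕ} {c δ : F} (hc : c ∈ gf F k) (hc0 : c ≠ 0)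
    (H : F → ℤ) :
    ∑ x ∈ (gf F k).erase 0 with chi k x = δ, H (c * x) =
      ∑ x ∈ (gf F k).erase 0 with chi k x = chi k c * δ, H x := by
  refine Finset.sum_nbij' (fun x => c * x) (fun x => c⁻¹ * x) (fun x hx => ?_) (fun x hx => ?_)
    (fun x _ => inv_mul_cancel_left₀ hc0 x) (fun x _ => mul_inv_cancel_left₀ hc0 x)
    (fun _ _ => rfl)
  · obtain ⟨hx, hxδ⟩ := Finset.mem_filter.1 hx
    obtain ⟨hx0, hx⟩ := Finset.mem_erase.1 hx
    exact Finset.mem_filter.2 ⟨Finset.mem_erase.2 ⟨mul_ne_zero hc0 hx0, mul_mem_gf hc hx⟩,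
      by rw [chi_mul, hxδ]⟩
  · obtain ⟨hx, hxδ⟩ := Finset.mem_filter.1 hx
    obtain ⟨hx0, hx⟩ := Finset.mem_erase.1 hx
    exact Finset.mem_filter.2 ⟨Finset.mem_erase.2 ⟨mul_ne_zero (inv_ne_zero hc0) hx0,
      mul_mem_gf (inv_mem_gf hc) hx⟩,
      by rw [chi_mul, chi_inv, hxδ, inv_mul_cancel_left₀ (chi_ne_zero hc0)]⟩

/-- Closed form of `S_2` for `a = r ^ 4`. -/
theorem three_mul_S2_pow_four [Fintype F] [CharP F 2] {m j : ℕ} (hm : 0 < m)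
    (hj : 2 ^ m + 1 = 3 * j) (hc : #(gf F m) = 2 ^ m) (hc2 : #(gf F (2 * m)) = 2 ^ (2 * m))
    (hc4 : #(gf F (2 * (2 * m))) = 2 ^ (2 * (2 * m))) {r b ω γ : F} (hr : r ∈ gf F (2 * m))
    (hr0 : r ≠ 0) (hω : ω ∈ gf F (2 * m)) (hω0 : ω ≠ 0) (hγ : γ = b * chi (2 * m) ω)
    (hγ3 : γ ^ 3 = 1) :
    3 * S2 (4 * m) (2 * m) m ((r ^ 2) ^ 2) b ω =
      (if chi (2 * m) r * γ = 1 then 3 * 2 ^ m else 0) - 2 ^ m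
        - (if chi (2 * m) r * γ⁻¹ = 1 then 2 else -1) * cub (2 * m) r r - kloo (2 * m) r := by
  have hγ0 : γ ≠ 0 := by rintro rfl; simp at hγ3
  have hc' : r ^ 2 ∈ gf F (2 * m) := pow_mem_gf hr 2
  have hr20 : r ^ 2 ≠ 0 := pow_ne_zero 2 hr0
  have hr3 := chi_cube hj hr hr0
  rw [S2_eq_sum_rootsOne hm hj hc' hω hω0, ← hγ,
    sum_rootsOne_add_inv (by omega) hc2 hc4 (fun x => if x ≠ 0 ∧ γ * chi (2 * m) x = 1
      then sgn (absTr (2 * m) (r ^ 2 * x)) else 0)]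
  have hterm : ∀ x ∈ (gf F (2 * m)).erase 0, (1 - sgn (absTr (2 * m) x⁻¹)) *
      (if x ≠ 0 ∧ γ * chi (2 * m) x = 1 then sgn (absTr (2 * m) (r ^ 2 * x)) else 0) =
      if chi (2 * m) x = γ⁻¹ then sgn (absTr (2 * m) (r ^ 2 * x)) -
        sgn (absTr (2 * m) (r * (r * x + (r * x)⁻¹))) else 0 := by
    intro x hx
    obtain ⟨hx0, hx⟩ := Finset.mem_erase.1 hx
    have h1 : (x ≠ 0 ∧ γ * chi (2 * m) x = 1) ↔ chi (2 * m) x = γ⁻¹ := by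
      rw [and_iff_right hx0, mul_comm]
      exact ⟨eq_inv_of_mul_eq_one_left, fun h => by rw [h, inv_mul_cancel₀ hγ0]⟩
    have h2 : r * (r * x + (r * x)⁻¹) = r ^ 2 * x + x⁻¹ := by field_simp
    simp only [h1, h2, sgn_absTr_add (mul_mem_gf hc' hx) (inv_mem_gf hx)]
    split_ifs <;> ring
  rw [Finset.sum_congr rfl hterm, ← Finset.sum_filter, Finset.sum_sub_distrib,
    sum_chi_mul_eq hc' hr20 (fun x => sgn (absTr (2 * m) x)),
    sum_chi_mul_eq hr hr0 (fun x => sgn (absTr (2 * m) (r * (x + x⁻¹))))]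
  have hcub := sum_chi_eq_sgn_mul_add_inv hm hj hc2 hc4 hr hr0
    (ε := chi (2 * m) r * γ⁻¹) (by rw [mul_pow, inv_pow, hr3, hγ3, inv_one, mul_one])
  have hgauss := sum_chi_eq_sgn_absTr hm hj hc hc2
    (δ := chi (2 * m) (r ^ 2) * γ⁻¹) (by
      rw [mul_pow, inv_pow, hγ3, inv_one, mul_one]
      exact chi_cube hj hc' hr20)
  have hiff : chi (2 * m) (r ^ 2) * γ⁻¹ = 1 ↔ chi (2 * m) r * γ = 1 := by
    have h1 : chi (2 * m) (r ^ 2) * chi (2 * m) r = 1 := by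
      rw [← hr3, sq, chi_mul]; ring
    rw [eq_inv_of_mul_eq_one_left h1, ← mul_inv, inv_eq_one]
  simp only [hiff] at hgauss
  rw [hgauss, if_neg (fun h => h.1 rfl)]
  have hj' : (2 : ℤ) ^ m + 1 = 3 * j := by exact_mod_cast hj
  split_ifs at hcub ⊢ <;> linarith

end Reduction

/-- For `ν = 2` (so `n = 4·m₂` with `m₂` odd, `m₁ = 2·m₂`), `a ∈ F_{2^{m₁}}^*`,
`b ∈ F_4^*` and `ω ∈ F_{2^{m₁}}^*` with polar decomposition `ω = w₂·y` in `F_{2^{m₁}}^*`,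
setting `γ = b·χ_{m₁}(w₂)` and `α = χ_{m₁}(a)`, the value `3·S_2(a,b,ω)` equals
`2^{m₂+1} − 2·C_{m₁}(a,a) − K_{m₁}(a)` if `γ = α` and `γ = α⁻¹`;
`−2^{m₂} − 2·C_{m₁}(a,a) − K_{m₁}(a)` if `γ = α` and `γ ≠ α⁻¹`;
`2^{m₂+1} + C_{m₁}(a,a) − K_{m₁}(a)` if `γ ≠ α` and `γ = α⁻¹`;
`−2^{m₂} + C_{m₁}(a,a) − K_{m₁}(a)` if `γ ≠ α` and `γ ≠ α⁻¹`. -/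
theorem S2_subfield_case_values
    {F : Type*} [Field F] [Fintype F]
    (n m1 m2 : ℕ) (hm2 : Odd m2) (hm1 : m1 = 2 * m2) (hn : n = 4 * m2)
    (hF : Fintype.card F = 2 ^ n)
    (a b : F) (ha : a ^ 2 ^ m1 = a) (ha0 : a ≠ 0) (hb : b ^ 3 = 1) (hb0 : b ≠ 0)
    (ω w2 y : F) (hω : ω ^ 2 ^ m1 = ω) (hω0 : ω ≠ 0)
    (hw2 : w2 ^ (2 ^ m2 + 1) = 1) (hy : y ^ 2 ^ m2 = y) (hy0 : y ≠ 0)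
    (hdec : ω = w2 * y)
    (γ α : F) (hγ : γ = b * chi m1 w2) (hα : α = chi m1 a) :
    (γ = α → γ = α⁻¹ →
      3 * S2 n m1 m2 a b ω = 2 ^ (m2 + 1) - 2 * cub m1 a a - kloo m1 a) ∧
    (γ = α → γ ≠ α⁻¹ →
      3 * S2 n m1 m2 a b ω = -2 ^ m2 - 2 * cub m1 a a - kloo m1 a) ∧
    (γ ≠ α → γ = α⁻¹ →
      3 * S2 n m1 m2 a b ω = 2 ^ (m2 + 1) + cub m1 a a - kloo m1 a) ∧
    (γ ≠ α → γ ≠ α⁻¹ →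
      3 * S2 n m1 m2 a b ω = -2 ^ m2 + cub m1 a a - kloo m1 a) := by
  have hm0 : 0 < m2 := hm2.pos
  subst hm1 hn
  have : CharP F 2 := by
    obtain ⟨p, hp⟩ := CharP.exists F
    have hpp : p.Prime := CharP.char_is_prime F p
    obtain ⟨d, -, hd⟩ := FiniteField.card F p
    have h1 : p ∣ 2 ^ (4 * m2) := by
      rw [← hF, hd]
      exact dvd_pow_self p d.pos.ne'
    rwa [(Nat.prime_dvd_prime_iff_eq hpp Nat.prime_two).1 (hpp.dvd_of_dvd_pow h1)] at hp
  have hc4 : #(gf F (2 * (2 * m2))) = 2 ^ (2 * (2 * m2)) := by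
    have h4 : 4 * m2 = 2 * (2 * m2) := by ring
    rw [h4] at hF
    rw [← hF, ← Finset.card_univ]
    congr 1
    refine Finset.filter_true_of_mem fun x _ => ?_
    rw [← hF, FiniteField.pow_card]
  have hc2 := card_gf_of_two_mul (by omega) hc4
  have hc := card_gf_of_two_mul hm0 hc2
  obtain ⟨j, hj⟩ : 3 ∣ 2 ^ m2 + 1 := by
    have := hm2.nat_add_dvd_pow_add_pow 2 1
    simpa using this
  obtain ⟨c, hcm, rfl⟩ := exists_sq_eq_of_mem_gf (k := 2 * m2) (by omega) (mem_gf.2 ha)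
  obtain ⟨r, hr, rfl⟩ := exists_sq_eq_of_mem_gf (k := 2 * m2) (by omega) hcm
  have hr0 : r ≠ 0 := by
    rintro rfl
    simp at ha0
  have hr3 := chi_cube hj hr hr0
  have hαr : α = chi (2 * m2) r := by
    rw [hα, sq, sq, chi_mul, chi_mul]
    linear_combination chi (2 * m2) r * hr3
  have hγω : γ = b * chi (2 * m2) ω := by
    rw [hγ, hdec, chi_mul, chi_eq_one_of_mem_gf hj (mem_gf.2 hy) hy0, mul_one]
  have hγ3 : γ ^ 3 = 1 := by
    rw [hγω, mul_pow, hb, chi_cube hj (mem_gf.2 hω) hω0, mul_one]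
  have hα0 : α ≠ 0 := hαr ▸ chi_ne_zero hr0
  have hγ0 : γ ≠ 0 := by rintro rfl; simp at hγ3
  have key := three_mul_S2_pow_four hm0 hj hc hc2 hc4 hr hr0 (mem_gf.2 hω) hω0 hγω hγ3
  have h1 : chi (2 * m2) r * γ = 1 ↔ γ = α⁻¹ := by
    rw [← hαr, mul_comm]
    exact ⟨eq_inv_of_mul_eq_one_left, fun h => by rw [h, inv_mul_cancel₀ hα0]⟩
  have h2 : chi (2 * m2) r * γ⁻¹ = 1 ↔ γ = α := by
    rw [← hαr, mul_inv_eq_one₀ hγ0, eq_comm]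
  simp only [h1, h2] at key
  rw [key, kloo_sq (by omega) hcm, kloo_sq (by omega) hr, cub_sq (by omega) hcm hcm,
    cub_sq (by omega) hr hr]
  refine ⟨fun h h' => ?_, fun h h' => ?_, fun h h' => ?_, fun h h' => ?_⟩
  · rw [if_pos h, if_pos h']; ring
  · rw [if_pos h, if_neg h']; ring
  · rw [if_neg h, if_pos h']; ring
  · rw [if_neg h, if_neg h']; ring
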